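/- For α ∈ [1/2, 1] and Lebesgue-almost every x ∈ [α−1, α), the limit lim_{n→∞} (1/n) log |q_n(x)| exists and equals −(1/2) ∫_{[α−1, α)} log(t²) dμ_α(t), where q_n(x) is the denominator of the n-th convergent of the α-continued fraction expansion of x. -/

import Mathlib

open MeasureTheory Set

noncomputable def g : ℝ := (Real.sqrt 5 - 1) / 2

noncomputable def T (α : ℝ) (x : ℝ) : ℝ :=
  if x = 0 then 0 else 1 / x - ⌊1 / x + 1 - α⌋

noncomputable def digit (α : ℝ) (k : ℕ) (x : ℝ) : ℤ :=
  if (T α)^[k - 1] x = 0 then 0 else ⌊1 / ((T α)^[k - 1] x) + 1 - α⌋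

noncomputable def cylinder (α : ℝ) (n : ℕ) (a : ℕ → ℤ) : Set ℝ :=
  {x | x ∈ Set.Ico (α - 1) α ∧ ∀ k, 1 ≤ k → k ≤ n → digit α k x = a k}

def contQ (a : ℕ → ℤ) : ℕ → ℤ
  | 0 => 1
  | 1 => a 1
  | (n + 2) => a (n + 2) * contQ a (n + 1) + contQ a n

def contP (a : ℕ → ℤ) : ℕ → ℤ
  | 0 => 0
  | 1 => 1
  | (n + 2) => a (n + 2) * contP a (n + 1) + contP a n

noncomputable def NT (α : ℝ) (p : ℝ × ℝ) : ℝ × ℝ :=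
  if p.1 = 0 then (0, 0)
  else (1 / p.1 - ⌊1 / p.1 + 1 - α⌋, 1 / (p.2 + ⌊1 / p.1 + 1 - α⌋))

noncomputable def Omega (α : ℝ) : Set (ℝ × ℝ) :=
  ⋃ n : ℕ, closure ((NT α)^[n] '' (Set.Ico (α - 1) α ×ˢ ({0} : Set ℝ)))

def Sset (x y : ℝ) : Set (ℝ × ℝ) :=
  {(x, y), (-x, -y), (x + 1, y / (1 - y)), (1 - x, -y / (y + 1))}

noncomputable def jumpTime (α : ℝ) (x : ℝ) : ℕ :=
  sInf {n : ℕ | 1 ≤ n ∧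
    (T α)^[n] '' cylinder α n (fun k => digit α k x) = Set.Ico (α - 1) α}

noncomputable def jumpT (α : ℝ) (x : ℝ) : ℝ := (T α)^[jumpTime α x] x

section Birkhoff

variable {X : Type*}

/-- `max (0, S₁, …, Sₙ)` where `Sₖ` is the `k`-th Birkhoff sum of `f` along `S`. -/
noncomputable def birkhoffMax (S : X → X) (f : X → ℝ) : ℕ → X → ℝ
  | 0 => fun _ => 0
  | n + 1 => fun x => max 0 (f x + birkhoffMax S f n (S x))

variable {S : X → X} {f : X → ℝ}

lemma birkhoffMax_nonneg (n : ℕ) (x : X) : 0 ≤ birkhoffMax S f n x := by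
  cases n <;> simp [birkhoffMax]

lemma birkhoffMax_le_succ (n : ℕ) (x : X) :
    birkhoffMax S f n x ≤ birkhoffMax S f (n + 1) x := by
  induction n generalizing x with
  | zero => exact birkhoffMax_nonneg 1 x
  | succ n ih =>
    simp only [birkhoffMax]
    exact max_le_max le_rfl (add_le_add le_rfl (ih (S x)))

lemma birkhoffSum_le_birkhoffMax (n : ℕ) (x : X) :
    birkhoffSum S f n x ≤ birkhoffMax S f n x := by
  induction n generalizing x with
  | zero => simp [birkhoffMax]
  | succ n ih =>
    rw [birkhoffSum_succ']
    exact (add_le_add le_rfl (ih (S x))).trans (le_max_right _ _)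

lemma birkhoffMax_succ_sub (n : ℕ) (x : X) :
    birkhoffMax S f (n + 1) x - birkhoffMax S f n (S x) =
      max (-birkhoffMax S f n (S x)) (f x) := by
  simp only [birkhoffMax]
  rw [← max_sub_sub_right]
  simp

variable [MeasurableSpace X] {μ : Measure X}

lemma measurable_birkhoffMax (hS : Measurable S) (hf : Measurable f) (n : ℕ) :
    Measurable (birkhoffMax S f n) := by
  induction n with
  | zero => exact measurable_const
  | succ n ih => exact measurable_const.max (hf.add (ih.comp hS))

lemma integrable_birkhoffMax (hS : MeasurePreserving S μ μ) (hf : Integrable f μ) (n : ℕ) :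
    Integrable (birkhoffMax S f n) μ := by
  induction n with
  | zero => exact integrable_zero X ℝ μ
  | succ n ih =>
    refine ((hf.add (hS.integrable_comp_of_integrable ih)).pos_part).congr ?_
    filter_upwards with x
    simp [birkhoffMax, max_comm]

/-- If `∫ f < 0`, the Birkhoff sums of `f` along an ergodic map are almost everywhere bounded
above. -/
lemma ae_bddAbove_birkhoffSum (hS : Ergodic S μ) (hfm : Measurable f) (hf : Integrable f μ)
    (hneg : ∫ x, f x ∂μ < 0) :
    ∀ᵐ x ∂μ, ∃ B : ℝ, ∀ n, birkhoffSum S f n x ≤ B := by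
  set A : Set X := {x | ∀ N : ℕ, ∃ n, (N : ℝ) < birkhoffMax S f n x} with hA
  have hAm : MeasurableSet A := by
    have : A = ⋂ N : ℕ, ⋃ n : ℕ, {x | (N : ℝ) < birkhoffMax S f n x} := by
      ext x; simp [hA]
    rw [this]
    exact MeasurableSet.iInter fun N => MeasurableSet.iUnion fun n =>
      measurableSet_lt measurable_const (measurable_birkhoffMax hS.measurable hfm n)
  have hAinv : S ⁻¹' A = A := by
    ext x
    simp only [hA, mem_preimage, mem_ofPred_eq]
    constructor
    · intro h N
      obtain ⟨K, hK⟩ := exists_nat_gt ((N : ℝ) - f x)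
      obtain ⟨n, hn⟩ := h K
      refine ⟨n + 1, lt_of_lt_of_le ?_ (le_max_right _ _)⟩
      linarith
    · intro h N
      obtain ⟨K, hK⟩ := exists_nat_gt ((N : ℝ) + f x)
      obtain ⟨n, hn⟩ := h K
      have h1 := hn.trans_le (birkhoffMax_le_succ n x)
      refine ⟨n, ?_⟩
      simp only [birkhoffMax] at h1
      rcases lt_max_iff.1 h1 with h2 | h2
      · exact absurd h2 (not_lt.2 (Nat.cast_nonneg K))
      · linarith
  rcases hS.ae_mem_or_ae_notMem hAm hAinv with h | h
  · exfalso
    have hlim : Filter.Tendsto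
        (fun n => ∫ x, (birkhoffMax S f (n + 1) x - birkhoffMax S f n (S x)) ∂μ)
        Filter.atTop (nhds (∫ x, f x ∂μ)) := by
      refine tendsto_integral_of_dominated_convergence (fun x => |f x|) ?_ hf.abs ?_ ?_
      · intro n
        exact ((measurable_birkhoffMax hS.measurable hfm _).sub
          ((measurable_birkhoffMax hS.measurable hfm _).comp hS.measurable)).aestronglyMeasurable
      · intro n
        filter_upwards with x
        rw [birkhoffMax_succ_sub, Real.norm_eq_abs, abs_le]
        exact ⟨(neg_abs_le _).trans (le_max_right _ _),
          max_le ((neg_nonpos.2 (birkhoffMax_nonneg _ _)).trans (abs_nonneg _)) (le_abs_self _)⟩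
      · filter_upwards [h] with x hx
        rw [← hAinv] at hx
        obtain ⟨K, hK⟩ := exists_nat_gt (-f x)
        obtain ⟨n, hn⟩ := hx K
        have hmono : Monotone fun n => birkhoffMax S f n (S x) :=
          monotone_nat_of_le_succ fun n => birkhoffMax_le_succ n (S x)
        refine tendsto_const_nhds.congr' ?_
        filter_upwards [Filter.eventually_ge_atTop n] with m hm
        have := hmono hm
        simp only at this
        rw [birkhoffMax_succ_sub, max_eq_right]
        linarith
    refine absurd (ge_of_tendsto' hlim fun n => ?_) (not_le.2 hneg)
    have hi := fun n => integrable_birkhoffMax hS.toMeasurePreserving hf n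
    have hi' : Integrable (fun x => birkhoffMax S f n (S x)) μ :=
      hS.toMeasurePreserving.integrable_comp_of_integrable (hi n)
    rw [integral_sub (hi _) hi', sub_nonneg]
    have : ∫ x, birkhoffMax S f n (S x) ∂μ = ∫ x, birkhoffMax S f n x ∂μ := by
      conv_rhs => rw [← hS.map_eq]
      rw [integral_map hS.measurable.aemeasurable
        (measurable_birkhoffMax hS.measurable hfm n).aestronglyMeasurable]
    rw [this]
    exact integral_mono (hi _) (hi _) (birkhoffMax_le_succ n)
  · filter_upwards [h] with x hx
    simp only [hA, mem_ofPred_eq, not_forall, not_exists, not_lt] at hx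
    obtain ⟨N, hN⟩ := hx
    exact ⟨N, fun n => (birkhoffSum_le_birkhoffMax n x).trans (hN n)⟩

lemma ae_eventually_birkhoffSum_le [IsProbabilityMeasure μ] (hS : Ergodic S μ)
    (hfm : Measurable f) (hf : Integrable f μ) {c : ℝ} (hc : ∫ x, f x ∂μ < c) :
    ∀ᵐ x ∂μ, ∀ᶠ n : ℕ in Filter.atTop, birkhoffSum S f n x / n ≤ c := by
  obtain ⟨d, hd, hdc⟩ := exists_between hc
  have h := ae_bddAbove_birkhoffSum (f := fun x => f x - d) hS (hfm.sub_const d)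
    (hf.sub (integrable_const d)) (by
      rw [integral_sub hf (integrable_const d)]; simpa using hd)
  filter_upwards [h] with x ⟨B, hB⟩
  have hlim : Filter.Tendsto (fun n : ℕ => B / (n : ℝ) + d) Filter.atTop (nhds (0 + d)) :=
    (tendsto_const_div_atTop_nhds_zero_nat B).add_const d
  rw [zero_add] at hlim
  filter_upwards [hlim.eventually_lt_const hdc, Filter.eventually_gt_atTop 0] with n hn hn0
  have hn0' : (0 : ℝ) < n := Nat.cast_pos.2 hn0
  refine le_trans ?_ hn.le
  have h1 := hB n
  simp only [birkhoffSum, Finset.sum_sub_distrib, Finset.sum_const, Finset.card_range,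
    nsmul_eq_mul] at h1 ⊢
  rw [div_add' _ _ _ hn0'.ne']
  gcongr
  linarith

/-- **Birkhoff's ergodic theorem** for an ergodic probability measure. -/
theorem ae_tendsto_birkhoffSum_div [IsProbabilityMeasure μ] (hS : Ergodic S μ)
    (hfm : Measurable f) (hf : Integrable f μ) :
    ∀ᵐ x ∂μ, Filter.Tendsto (fun n : ℕ => birkhoffSum S f n x / n) Filter.atTop
      (nhds (∫ x, f x ∂μ)) := by
  obtain ⟨u, -, hu, hulim⟩ := exists_seq_strictAnti_tendsto (0 : ℝ)
  have h1 : ∀ᵐ x ∂μ, ∀ k, ∀ᶠ n : ℕ in Filter.atTop,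
      birkhoffSum S f n x / n ≤ ∫ x, f x ∂μ + u k :=
    ae_all_iff.2 fun k => ae_eventually_birkhoffSum_le hS hfm hf (lt_add_of_pos_right _ (hu k))
  have h2 : ∀ᵐ x ∂μ, ∀ k, ∀ᶠ n : ℕ in Filter.atTop,
      birkhoffSum S (fun x => -f x) n x / n ≤ -∫ x, f x ∂μ + u k :=
    ae_all_iff.2 fun k => ae_eventually_birkhoffSum_le hS hfm.neg hf.neg (by
      simp only [Pi.neg_apply, integral_neg]
      exact lt_add_of_pos_right _ (hu k))
  filter_upwards [h1, h2] with x hx1 hx2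
  rw [tendsto_order]
  constructor
  · intro a ha
    obtain ⟨k, hk⟩ := (hulim.eventually_lt_const (sub_pos.2 ha)).exists
    filter_upwards [hx2 k] with n hn
    simp only [birkhoffSum, Finset.sum_neg_distrib, neg_div] at hn ⊢
    linarith
  · intro a ha
    obtain ⟨k, hk⟩ := (hulim.eventually_lt_const (sub_pos.2 ha)).exists
    filter_upwards [hx1 k] with n hn
    linarith

/-- A nonnegative function whose Birkhoff sums grow at most linearly is integrable. -/
lemma integrable_of_birkhoffSum_le [IsProbabilityMeasure μ] (hS : Ergodic S μ)
    (hfm : Measurable f) (hf0 : ∀ᵐ x ∂μ, 0 ≤ f x) {K : ℝ}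
    (hK : ∀ᵐ x ∂μ, ∀ᶠ n : ℕ in Filter.atTop, birkhoffSum S f n x ≤ n * K) :
    Integrable f μ := by
  have hmin : ∀ M : ℕ, Integrable (fun x => min (f x) M) μ := fun M => by
    refine Integrable.of_bound (hfm.min measurable_const).aestronglyMeasurable (M : ℝ) ?_
    filter_upwards [hf0] with x hx
    rw [Real.norm_eq_abs, abs_of_nonneg (le_min hx M.cast_nonneg)]
    exact min_le_right _ _
  have hle : ∀ M : ℕ, ∫ x, min (f x) M ∂μ ≤ K := fun M => by
    obtain ⟨x, hx, hxK⟩ := ((ae_tendsto_birkhoffSum_div hS (hfm.min measurable_const)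
      (hmin M)).and hK).exists
    refine le_of_tendsto hx ?_
    filter_upwards [hxK, Filter.eventually_gt_atTop 0] with n hn hn0
    rw [div_le_iff₀ (Nat.cast_pos.2 hn0), mul_comm]
    exact (Finset.sum_le_sum fun k _ => min_le_left _ _).trans hn
  refine ⟨hfm.aestronglyMeasurable, ?_⟩
  rw [hasFiniteIntegral_iff_ofReal hf0]
  refine lt_of_le_of_lt ?_ (ENNReal.ofReal_lt_top (r := K))
  have hlim : ∀ x, Filter.Tendsto (fun M : ℕ => ENNReal.ofReal (min (f x) M)) Filter.atTop
      (nhds (ENNReal.ofReal (f x))) := fun x => by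
    refine tendsto_const_nhds.congr' ?_
    obtain ⟨N, hN⟩ := exists_nat_ge (f x)
    filter_upwards [Filter.eventually_ge_atTop N] with M hM
    rw [min_eq_left (hN.trans (Nat.cast_le.2 hM))]
  refine le_of_tendsto' (lintegral_tendsto_of_tendsto_of_monotone
    (fun M => (hfm.min measurable_const).ennreal_ofReal.aemeasurable)
    (ae_of_all _ fun x M N h => ENNReal.ofReal_le_ofReal
      (min_le_min le_rfl (Nat.cast_le.2 h))) (ae_of_all _ hlim)) fun M => ?_
  rw [← ofReal_integral_eq_lintegral_ofReal (hmin M)]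
  · exact ENNReal.ofReal_le_ofReal (hle M)
  · filter_upwards [hf0] with x hx using le_min hx M.cast_nonneg

end Birkhoff

section ContinuedFraction

lemma T_mem_Ico {α x : ℝ} (hx : x ∈ Ico (α - 1) α) :
    T α x ∈ Ico (α - 1) α := by
  unfold T
  split_ifs with h
  · exact h ▸ hx
  · have h1 := Int.floor_le (1 / x + 1 - α)
    have h2 := Int.lt_floor_add_one (1 / x + 1 - α)
    constructor <;> linarith

lemma iterate_T_mem_Ico {α x : ℝ} (hx : x ∈ Ico (α - 1) α) (n : ℕ) : (T α)^[n] x ∈ Ico (α - 1) α := by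
  induction n with
  | zero => exact hx
  | succ n ih =>
    rw [Function.iterate_succ_apply']
    exact T_mem_Ico ih

/-- The region containing all pairs `(qₙ₋₁ / qₙ, Tⁿ x)`. -/
def DenominatorRegion (α v t : ℝ) : Prop :=
  (α ^ 2 + α ≤ 1 ∧ |v| ≤ 1) ∨
  (1 < α ^ 2 + α ∧ ((-(1 / 2) ≤ v ∧ v ≤ 2 / 3) ∨ (0 ≤ v ∧ v ≤ 2 ∧ 0 < t)))

lemma DenominatorRegion.bounds {α v t : ℝ} (hα : α ∈ Icc (1 / 2 : ℝ) 1)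
    (ht : t ∈ Ico (α - 1) α) (h : DenominatorRegion α v t) :
    1 / 3 ≤ 1 + v * t ∧ 1 + v * t ≤ 3 := by
  obtain ⟨hα1, hα2⟩ := hα
  obtain ⟨ht1, ht2⟩ := ht
  rcases h with ⟨h1, hv⟩ | ⟨h1, ⟨hv1, hv2⟩ | ⟨hv1, hv2, ht0⟩⟩
  · have hα3 : α ≤ 2 / 3 := by nlinarith
    have : |v * t| ≤ 1 * (2 / 3) := by
      rw [abs_mul]
      exact mul_le_mul hv (abs_le.2 ⟨by linarith, by linarith⟩) (abs_nonneg _) zero_le_one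
    have := abs_le.1 this
    constructor <;> linarith
  · have : |v * t| ≤ 2 / 3 * 1 := by
      rw [abs_mul]
      exact mul_le_mul (abs_le.2 ⟨by linarith, by linarith⟩)
        (abs_le.2 ⟨by linarith, by linarith⟩) (abs_nonneg _) (by norm_num)
    have := abs_le.1 this
    constructor <;> linarith
  · constructor <;> nlinarith

lemma DenominatorRegion.step {α v t t' : ℝ} {a : ℤ} (hα : α ∈ Icc (1 / 2 : ℝ) 1)
    (ht : t ∈ Ico (α - 1) α) (ht' : t' ∈ Ico (α - 1) α) (ht0 : t ≠ 0)
    (hta : t⁻¹ = a + t') (h : DenominatorRegion α v t) :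
    (a : ℝ) + v ≠ 0 ∧ DenominatorRegion α ((a : ℝ) + v)⁻¹ t' := by
  obtain ⟨hα1, hα2⟩ := hα
  obtain ⟨ht1, ht2⟩ := ht
  obtain ⟨ht1', ht2'⟩ := ht'
  have hmul : (a + t') * t = 1 := by rw [← hta, inv_mul_cancel₀ ht0]
  rcases h with ⟨h1, hv⟩ | ⟨h1, hv⟩
  · have hv' := abs_le.1 hv
    have key : 1 ≤ |(a : ℝ) + v| := by
      rcases ht0.lt_or_gt with hneg | hpos
      · have : (a : ℝ) < -1 := by
          by_contra! hcon
          nlinarith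
        have : a < -1 := by exact_mod_cast this
        have : (a : ℝ) ≤ -2 := by exact_mod_cast (by omega : a ≤ -2)
        exact le_abs.2 (Or.inr (by linarith))
      · have : (1 : ℝ) < a := by
          by_contra! hcon
          nlinarith
        have : 1 < a := by exact_mod_cast this
        have : (2 : ℝ) ≤ a := by exact_mod_cast (by omega : 2 ≤ a)
        exact le_abs.2 (Or.inl (by linarith))
    refine ⟨abs_pos.1 (by linarith), Or.inl ⟨h1, ?_⟩⟩
    rw [abs_inv]
    exact inv_le_one_of_one_le₀ key
  · rcases ht0.lt_or_gt with hneg | hpos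
    · have hv : -(1 / 2) ≤ v ∧ v ≤ 2 / 3 := by
        rcases hv with hv | hv
        · exact hv
        · exact absurd hv.2.2 hneg.le.not_gt
      have : (a : ℝ) < -2 := by
        by_contra! hcon
        nlinarith
      have : a < -2 := by exact_mod_cast this
      have : (a : ℝ) ≤ -3 := by exact_mod_cast (by omega : a ≤ -3)
      have hs : (a : ℝ) + v ≤ -(7 / 3) := by linarith [hv.2]
      refine ⟨by linarith, Or.inr ⟨h1, Or.inl ⟨?_, ?_⟩⟩⟩
      · rw [← neg_neg ((a : ℝ) + v), inv_neg, neg_le_neg_iff, inv_eq_one_div]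
        exact one_div_le_one_div_of_le (by norm_num) (by linarith)
      · exact (inv_nonpos.2 (by linarith)).trans (by norm_num)
    · have hv : -(1 / 2) ≤ v := by rcases hv with hv | hv <;> linarith [hv.1]
      have : (0 : ℝ) < a := by
        by_contra! hcon
        nlinarith
      have ha : 0 < a := by exact_mod_cast this
      rcases (show a = 1 ∨ 2 ≤ a by omega) with rfl | ha2
      · push_cast at *
        have hs : 1 / 2 ≤ 1 + v := by linarith
        refine ⟨by linarith, Or.inr ⟨h1, Or.inr ⟨inv_nonneg.2 (by linarith), ?_, ?_⟩⟩⟩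
        · rw [inv_le_comm₀ (by linarith) (by norm_num)]
          linarith
        · by_contra! hcon
          nlinarith
      · have : (2 : ℝ) ≤ a := by exact_mod_cast ha2
        have hs : 3 / 2 ≤ (a : ℝ) + v := by linarith
        refine ⟨by linarith, Or.inr ⟨h1, Or.inl ⟨?_, ?_⟩⟩⟩
        · exact le_trans (by norm_num) (inv_nonneg.2 (by linarith : 0 ≤ (a : ℝ) + v))
        · rw [inv_le_comm₀ (by linarith) (by norm_num)]
          linarith

lemma digit_succ_add_iterate {α x : ℝ} (n : ℕ) (h : (T α)^[n] x ≠ 0) :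
    ((T α)^[n] x)⁻¹ = digit α (n + 1) x + (T α)^[n + 1] x := by
  rw [Function.iterate_succ_apply']
  simp [digit, T, h]

/-- The orbit product is `qₙ + qₙ₋₁ Tⁿ x`, written as `qₙ (1 + v Tⁿ x)` with `v = qₙ₋₁ / qₙ`. -/
lemma exists_ratio {α x : ℝ} (hα : α ∈ Icc (1 / 2 : ℝ) 1) (hx : x ∈ Ico (α - 1) α)
    (h0 : ∀ n, (T α)^[n] x ≠ 0) (n : ℕ) :
    ∃ v : ℝ, (contQ (fun k => digit α k x) n : ℝ) ≠ 0 ∧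
      ∏ k ∈ Finset.range n, ((T α)^[k] x)⁻¹ =
        contQ (fun k => digit α k x) n * (1 + v * (T α)^[n] x) ∧
      (contQ (fun k => digit α k x) (n + 1) : ℝ) =
        contQ (fun k => digit α k x) n * (digit α (n + 1) x + v) ∧
      DenominatorRegion α v ((T α)^[n] x) := by
  induction n with
  | zero =>
    refine ⟨0, by simp [contQ], by simp [contQ], by simp [contQ], ?_⟩
    rcases le_or_gt (α ^ 2 + α) 1 with h | h
    · exact Or.inl ⟨h, by simp⟩
    · exact Or.inr ⟨h, Or.inl ⟨by norm_num, by norm_num⟩⟩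
  | succ n ih =>
    obtain ⟨v, hq, hprod, hrec, hreg⟩ := ih
    have hd := digit_succ_add_iterate n (h0 n)
    obtain ⟨hne, hreg'⟩ := hreg.step hα (iterate_T_mem_Ico hx n)
      (iterate_T_mem_Ico hx (n + 1)) (h0 n) hd
    refine ⟨_, by rw [hrec]; exact mul_ne_zero hq hne, ?_, ?_, hreg'⟩
    · rw [Finset.prod_range_succ, hprod, hrec, mul_assoc, add_mul, one_mul, mul_assoc,
        mul_inv_cancel₀ (h0 n), hd]
      field_simp
      ring
    · rw [contQ]
      push_cast
      rw [hrec]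
      field_simp

lemma abs_log_contQ_sub_birkhoffSum_le {α x : ℝ} (hα : α ∈ Icc (1 / 2 : ℝ) 1)
    (hx : x ∈ Ico (α - 1) α) (h0 : ∀ n, (T α)^[n] x ≠ 0) (n : ℕ) :
    |Real.log |(contQ (fun k => digit α k x) n : ℝ)| -
      birkhoffSum (T α) (fun t => -Real.log t) n x| ≤ Real.log 3 := by
  obtain ⟨v, hq, hprod, -, hreg⟩ := exists_ratio hα hx h0 n
  obtain ⟨hb1, hb2⟩ := hreg.bounds hα (iterate_T_mem_Ico hx n)
  have hpos : 0 < 1 + v * (T α)^[n] x := by linarith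
  have h1 : birkhoffSum (T α) (fun t => -Real.log t) n x =
      Real.log (∏ k ∈ Finset.range n, ((T α)^[k] x)⁻¹) := by
    rw [Real.log_prod fun k _ => inv_ne_zero (h0 k)]
    simp [birkhoffSum, Real.log_inv]
  rw [h1, hprod, Real.log_mul hq hpos.ne', Real.log_abs, sub_add_cancel_left, abs_neg, abs_le]
  refine ⟨?_, Real.log_le_log hpos hb2⟩
  rw [← Real.log_inv, inv_eq_one_div]
  exact Real.log_le_log (by norm_num) hb1

lemma exists_transfer_bound {α : ℝ} (hα : α ∈ Icc (1 / 2 : ℝ) 1) :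
    ∃ C : ℝ, 0 < C ∧ ∀ h : ℝ → ENNReal,
      ∫⁻ x in Ico (α - 1) α, ENNReal.ofReal (Real.exp (-Real.log x / 2)) * h (T α x) ≤
        ENNReal.ofReal C * ∫⁻ x in Ico (α - 1) α, h x := by
  obtain ⟨hα1, hα2⟩ := hα
  set c : ℤ → ℝ := fun a => 2 ^ (3 / 2 : ℝ) * (1 / |(a : ℝ) + 1 / 2| ^ (3 / 2 : ℝ)) with hc
  have hcs : Summable c :=
    ((Real.summable_one_div_int_add_rpow (1 / 2) (3 / 2)).2 (by norm_num)).mul_left _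
  have hc0 : ∀ a, 0 ≤ c a := fun a => by positivity
  refine ⟨∑' a, c a + 1, by
    have : 0 ≤ ∑' a, c a := tsum_nonneg hc0
    linarith, fun h => ?_⟩
  set J : ℤ → Set ℝ := fun a => {y | y ∈ Ico (α - 1) α ∧ 1 ≤ |(a : ℝ) + y|}
  have hJm : ∀ a, MeasurableSet (J a) := fun a =>
    measurableSet_Ico.inter
      (measurableSet_le measurable_const (measurable_const_add (a : ℝ)).abs)
  have hJ0 : ∀ a, ∀ y ∈ J a, (a : ℝ) + y ≠ 0 := fun a y hy =>
    abs_pos.1 (zero_lt_one.trans_le hy.2)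
  set φ : ℤ → ℝ → ℝ := fun a y => ((a : ℝ) + y)⁻¹ with hφ
  have hcover : Ico (α - 1) α ⊆ {0} ∪ ⋃ a, φ a '' J a := by
    intro x hx
    rcases eq_or_ne x 0 with h0 | h0
    · exact Or.inl h0
    · refine Or.inr (mem_iUnion.2 ⟨⌊1 / x + 1 - α⌋, T α x, ⟨T_mem_Ico hx, ?_⟩, ?_⟩)
      · simp only [T, h0, if_false, add_sub_cancel]
        rw [abs_div, abs_one]
        exact one_le_one_div (abs_pos.2 h0) (abs_le.2 ⟨by linarith [hx.1], by linarith [hx.2]⟩)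
      · simp [hφ, T, h0]
  have hT : ∀ a, ∀ y ∈ J a, T α (φ a y) = y := fun a y hy => by
    have h0 := hJ0 a y hy
    have hfl : ⌊(a : ℝ) + y + 1 - α⌋ = a := by
      rw [Int.floor_eq_iff]
      constructor <;> linarith [hy.1.1, hy.1.2]
    simp [T, hφ, h0, hfl]
  have hbranch : ∀ a, ∫⁻ x in φ a '' J a,
      ENNReal.ofReal (Real.exp (-Real.log x / 2)) * h (T α x) ≤
        ENNReal.ofReal (c a) * ∫⁻ x in Ico (α - 1) α, h x := fun a => by
    rw [lintegral_image_eq_lintegral_abs_deriv_mul (f := φ a)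
      (f' := fun y => -1 / ((a : ℝ) + y) ^ 2)
      (hJm a) (fun y hy => (((hasDerivAt_id y).const_add (a : ℝ)).inv
        (hJ0 a y hy)).hasDerivWithinAt) (fun y _ z _ hyz => by
          simpa [hφ] using hyz)]
    rw [← lintegral_const_mul' _ _ ENNReal.ofReal_ne_top]
    refine (setLIntegral_mono' (hJm a) fun y hy => ?_).trans
      (lintegral_mono_set fun y hy => hy.1)
    rw [hT a y hy, ← mul_assoc, ← ENNReal.ofReal_mul (abs_nonneg _)]
    gcongr
    have hpos : 0 < |(a : ℝ) + y| := zero_lt_one.trans_le hy.2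
    have hne : (a : ℝ) + 1 / 2 ≠ 0 := fun hcon => by
      have : (2 * a + 1 : ℤ) = 0 := by
        have : (2 * a + 1 : ℝ) = 0 := by linarith
        exact_mod_cast this
      omega
    have hle : |(a : ℝ) + 1 / 2| / 2 ≤ |(a : ℝ) + y| := by
      have h1 : |(a : ℝ) + 1 / 2| ≤ |(a : ℝ) + y| + |1 / 2 - y| := by
        simpa using abs_add_le ((a : ℝ) + y) (1 / 2 - y)
      have h2 : |1 / 2 - y| ≤ 1 :=
        abs_le.2 ⟨by linarith [hy.1.2], by linarith [hy.1.1]⟩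
      linarith [hy.2]
    have hw : |-1 / ((a : ℝ) + y) ^ 2| * Real.exp (-Real.log (φ a y) / 2) =
        |(a : ℝ) + y| ^ (-(3 / 2) : ℝ) := by
      have h1 : |-1 / ((a : ℝ) + y) ^ 2| = |(a : ℝ) + y| ^ (-2 : ℝ) := by
        rw [Real.rpow_neg (abs_nonneg _), abs_div, abs_neg, abs_one, one_div, abs_pow]
        norm_num
      rw [h1, Real.rpow_def_of_pos hpos, Real.rpow_def_of_pos hpos, ← Real.exp_add]
      simp only [hφ, Real.log_inv, Real.log_abs]
      congr 1
      ring
    rw [hw, hc]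
    have hpos' : 0 < |(a : ℝ) + 1 / 2| := abs_pos.2 hne
    refine (Real.rpow_le_rpow_of_nonpos (by positivity) hle (by norm_num)).trans_eq ?_
    rw [Real.rpow_neg (by positivity), Real.div_rpow hpos'.le (by norm_num), inv_div]
    ring
  calc ∫⁻ x in Ico (α - 1) α, ENNReal.ofReal (Real.exp (-Real.log x / 2)) * h (T α x)
      ≤ ∫⁻ x in {0} ∪ ⋃ a, φ a '' J a,
          ENNReal.ofReal (Real.exp (-Real.log x / 2)) * h (T α x) := lintegral_mono_set hcover
    _ ≤ 0 + ∑' a, ∫⁻ x in φ a '' J a,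
          ENNReal.ofReal (Real.exp (-Real.log x / 2)) * h (T α x) := by
        refine (lintegral_union_le _ _ _).trans (add_le_add ?_ (lintegral_iUnion_le _ _))
        rw [Measure.restrict_eq_zero.2 (Real.volume_singleton), lintegral_zero_measure]
    _ ≤ ∑' a, ENNReal.ofReal (c a) * ∫⁻ x in Ico (α - 1) α, h x := by
        rw [zero_add]
        exact ENNReal.tsum_le_tsum hbranch
    _ = ENNReal.ofReal (∑' a, c a) * ∫⁻ x in Ico (α - 1) α, h x := by
        rw [ENNReal.tsum_mul_right, ENNReal.ofReal_tsum_of_nonneg hc0 hcs]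
    _ ≤ _ := by gcongr; linarith

lemma measurable_T (α : ℝ) : Measurable (T α) := by
  unfold T
  exact Measurable.ite (measurableSet_singleton 0) measurable_const (by fun_prop)

lemma measurable_birkhoffSum {X : Type*} [MeasurableSpace X] {S : X → X} {f : X → ℝ}
    (hS : Measurable S) (hf : Measurable f) (n : ℕ) : Measurable (birkhoffSum S f n) :=
  Finset.measurable_fun_sum _ fun k _ => hf.comp (hS.iterate k)

/-- The sums of `-log |Tᵏ x|` grow at most linearly, for Lebesgue-almost every `x`. -/
lemma exists_ae_birkhoffSum_log_le {α : ℝ} (hα : α ∈ Icc (1 / 2 : ℝ) 1) :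
    ∃ K : ℝ, ∀ᵐ x ∂(volume.restrict (Ico (α - 1) α)), ∀ᶠ n : ℕ in Filter.atTop,
      birkhoffSum (T α) (fun t => -Real.log t) n x ≤ n * K := by
  obtain ⟨C, hC, htr⟩ := exists_transfer_bound hα
  set B : ℕ → ℝ → ℝ := birkhoffSum (T α) (fun t => -Real.log t) with hB
  have hBm : ∀ n, Measurable (B n) :=
    measurable_birkhoffSum (measurable_T α) Real.measurable_log.neg
  have hW : ∀ n, ∫⁻ x in Ico (α - 1) α, ENNReal.ofReal (Real.exp (B n x / 2)) ≤
      ENNReal.ofReal (C ^ n) := fun n => by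
    induction n with
    | zero => simp [hB, birkhoffSum_zero]
    | succ n ih =>
      calc ∫⁻ x in Ico (α - 1) α, ENNReal.ofReal (Real.exp (B (n + 1) x / 2))
          = ∫⁻ x in Ico (α - 1) α, ENNReal.ofReal (Real.exp (-Real.log x / 2)) *
              ENNReal.ofReal (Real.exp (B n (T α x) / 2)) := by
            refine lintegral_congr fun x => ?_
            rw [← ENNReal.ofReal_mul (Real.exp_pos _).le, ← Real.exp_add, ← add_div, hB,
              birkhoffSum_succ']
        _ ≤ _ := htr fun x => ENNReal.ofReal (Real.exp (B n x / 2))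
        _ ≤ ENNReal.ofReal C * ENNReal.ofReal (C ^ n) := by gcongr
        _ = _ := by rw [← ENNReal.ofReal_mul hC.le, pow_succ']
  have hWm : ∀ n, Measurable fun x => ENNReal.ofReal (Real.exp (B n x / 2)) := fun n =>
    ((hBm n).div_const 2).exp.ennreal_ofReal
  have hfin : ∫⁻ x in Ico (α - 1) α, ∑' n : ℕ, ENNReal.ofReal ((1 / (2 * C)) ^ n) *
      ENNReal.ofReal (Real.exp (B n x / 2)) ≠ ⊤ := by
    rw [lintegral_tsum fun n => ((hWm n).const_mul _).aemeasurable]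
    refine ne_top_of_le_ne_top (b := ∑' n : ℕ, ENNReal.ofReal ((1 / 2) ^ n)) ?_
      (ENNReal.tsum_le_tsum fun n => ?_)
    · rw [← ENNReal.ofReal_tsum_of_nonneg (fun n => by positivity) summable_geometric_two]
      exact ENNReal.ofReal_ne_top
    · rw [lintegral_const_mul _ (hWm n)]
      refine (mul_le_mul_right (hW n) _).trans_eq ?_
      rw [← ENNReal.ofReal_mul (by positivity), ← mul_pow]
      congr 2
      field_simp
  refine ⟨2 * Real.log (2 * C), ?_⟩
  filter_upwards [ae_lt_top (Measurable.tsum fun n => (hWm n).const_mul _) hfin] with x hx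
  filter_upwards [(ENNReal.tendsto_atTop_zero_of_tsum_ne_top hx.ne).eventually_lt_const
    one_pos] with n hn
  rw [← ENNReal.ofReal_mul (by positivity), ENNReal.ofReal_lt_one, one_div, inv_pow,
    inv_mul_lt_iff₀ (by positivity), mul_one] at hn
  have := Real.log_le_log (Real.exp_pos _) hn.le
  rw [Real.log_exp, Real.log_pow] at this
  linarith

end ContinuedFraction

/-- For Lebesgue-a.e. x ∈ [α−1, α), lim (1/n) log |q_n(x)| exists and equals
−(1/2) ∫ log(t²) dμ_α(t). -/
theorem lyapunov_denominators (α : ℝ) (hα : α ∈ Set.Icc (1 / 2 : ℝ) 1)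
    (μ : Measure ℝ) (hprob : IsProbabilityMeasure μ) (herg : Ergodic (T α) μ)
    (hac : μ ≪ volume.restrict (Set.Ico (α - 1) α))
    (hca : volume.restrict (Set.Ico (α - 1) α) ≪ μ) :
    ∀ᵐ x ∂(volume.restrict (Set.Ico (α - 1) α)),
      Filter.Tendsto
        (fun n : ℕ => (1 / (n : ℝ)) *
          Real.log |(contQ (fun k => digit α k x) n : ℝ)|)
        Filter.atTop
        (nhds (-(1 / 2) * ∫ t, Real.log (t ^ 2) ∂μ)) := by
  have hμI : ∀ᵐ x ∂μ, x ∈ Ico (α - 1) α := hac.ae_le (ae_restrict_mem measurableSet_Ico)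
  have hμ0 : ∀ᵐ x ∂μ, ∀ n, (T α)^[n] x ≠ 0 := by
    have h0 : ∀ᵐ x ∂μ, x ≠ 0 := hac.ae_le (ae_restrict_of_ae (Measure.ae_ne volume 0))
    exact ae_all_iff.2 fun n => (herg.toMeasurePreserving.iterate n).quasiMeasurePreserving.ae h0
  obtain ⟨K, hK⟩ := exists_ae_birkhoffSum_log_le hα
  have hlogm : Measurable fun t : ℝ => -Real.log t := Real.measurable_log.neg
  have hint : Integrable (fun t => -Real.log t) μ := by
    refine integrable_of_birkhoffSum_le herg hlogm ?_ (hac.ae_le hK)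
    filter_upwards [hμI] with x hx
    rw [← Real.log_abs, neg_nonneg]
    exact Real.log_nonpos (abs_nonneg _)
      (abs_le.2 ⟨by linarith [hx.1, hα.1], by linarith [hx.2, hα.2]⟩)
  refine hca.ae_le ?_
  filter_upwards [hμI, hμ0, ae_tendsto_birkhoffSum_div herg hlogm hint] with x hx hx0 hlim
  have hval : -(1 / 2) * ∫ t, Real.log (t ^ 2) ∂μ = ∫ t, -Real.log t ∂μ := by
    simp only [Real.log_pow, integral_neg, integral_const_mul]
    push_cast
    ring
  rw [hval]
  have hdiff : Filter.Tendsto (fun n : ℕ => (1 / (n : ℝ)) *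
      Real.log |(contQ (fun k => digit α k x) n : ℝ)| -
        birkhoffSum (T α) (fun t => -Real.log t) n x / n) Filter.atTop (nhds 0) := by
    refine squeeze_zero_norm (fun n => ?_) (tendsto_const_div_atTop_nhds_zero_nat (Real.log 3))
    rw [one_div_mul_eq_div, ← sub_div, norm_div, Real.norm_eq_abs, Real.norm_natCast]
    gcongr
    exact abs_log_contQ_sub_birkhoffSum_le hα hx hx0 n
  simpa using hdiff.add hlim
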